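/- arXiv:2509.20137 — 2 statements merged into one kernel-verified Lean document; each statement's English description precedes it below -/
import Mathlib

section
/- Let 𝒜 be a Frobenius abelian category. Then for every object M of 𝒜, every projective object P of 𝒜 and every integer i ≥ 0, one has qpd_𝒜(M ⊕ P) = qpd_𝒜(M) = qpd_𝒜(Ω^i(M)), where Ω^i(M) is the i-th syzygy of M with respect to any projective resolution of M. -/
/-!
Quasi-projective dimension, following Gheibi–Jorgensen–Takahashi and
Chen–Chen–Liu, "Properties of quasi-projective dimension over abelian categories".
-/

open CategoryTheory CategoryTheory.Limits

attribute [local instance] CategoryTheory.Abelian.hasFiniteBiproducts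

noncomputable section

universe v u

namespace QPD

variable {A : Type*} [Category A] [Abelian A]

/-- The direct sum of `n` copies of `M`. -/
def copies (M : A) (n : ℕ) : A := ⨁ (fun _ : Fin n => M)

/-- `X` belongs to `add M`: it is a direct summand of a finite direct sum of copies of `M`. -/
def inAdd (M X : A) : Prop :=
  ∃ (n : ℕ) (s : X ⟶ copies M n) (r : copies M n ⟶ X), s ≫ r = 𝟙 X

/-- `P` is a quasi-projective resolution of `M`: a bounded-below complex of projective
objects whose `j`-th homology is a direct sum of `mult j` copies of `M`, where the
multiplicities `mult j` are not all zero. -/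
structure IsQuasiProjRes (M : A) (P : ChainComplex A ℤ) : Prop where
  projective : ∀ i, Projective (P.X i)
  bddBelow : ∃ a : ℤ, ∀ i, i < a → IsZero (P.X i)
  homology_iso : ∃ mult : ℤ → ℕ, (∃ j, mult j ≠ 0) ∧
    ∀ j, Nonempty (P.homology j ≅ copies M (mult j))

/-- `P` is a finite (i.e. bounded) quasi-projective resolution of `M`. -/
structure IsFiniteQuasiProjRes (M : A) (P : ChainComplex A ℤ) extends
    IsQuasiProjRes M P : Prop where
  bddAbove : ∃ b : ℤ, ∀ i, b < i → IsZero (P.X i)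

/-- `s` is the supremum of the degrees in which `P` is nonzero. -/
def IsSup (P : ChainComplex A ℤ) (s : ℤ) : Prop :=
  ¬ IsZero (P.X s) ∧ ∀ i, s < i → IsZero (P.X i)

/-- `t` is the supremum of the degrees in which the homology of `P` is nonzero. -/
def IsHSup (P : ChainComplex A ℤ) (t : ℤ) : Prop :=
  ¬ IsZero (P.homology t) ∧ ∀ i, t < i → IsZero (P.homology i)

/-- `t` is the infimum of the degrees in which the homology of `P` is nonzero. -/
def IsHInf (P : ChainComplex A ℤ) (t : ℤ) : Prop :=
  ¬ IsZero (P.homology t) ∧ ∀ i, i < t → IsZero (P.homology i)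

open Classical in
/-- The quasi-projective dimension of `M`, as an element of `ℕ∞`: the infimum of
`sup P• - hsup P•` over all finite quasi-projective resolutions `P•` of `M`
(it is `0` for the zero object and `⊤` if no finite quasi-projective resolution exists). -/
def qpd (M : A) : ℕ∞ :=
  if IsZero M then 0
  else sInf {d : ℕ∞ | ∃ (P : ChainComplex A ℤ) (s t : ℤ),
    IsFiniteQuasiProjRes M P ∧ IsSup P s ∧ IsHSup P t ∧ d = ((s - t).toNat : ℕ∞)}

/-- `M` admits a projective resolution of length at most `n`. -/
def pdLE (M : A) (n : ℕ) : Prop :=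
  ∃ P : ChainComplex A ℤ, (∀ i, Projective (P.X i)) ∧
    (∀ i : ℤ, i < 0 → IsZero (P.X i)) ∧ (∀ i : ℤ, (n : ℤ) < i → IsZero (P.X i)) ∧
    (∀ i : ℤ, i ≠ 0 → IsZero (P.homology i)) ∧ Nonempty (P.homology 0 ≅ M)

/-- The projective dimension of `M`, as an element of `ℕ∞`. -/
def pd (M : A) : ℕ∞ := sInf {d : ℕ∞ | ∃ n : ℕ, d = (n : ℕ∞) ∧ pdLE M n}

open Classical in
/-- Quasi-projective dimension computed using only complexes all of whose terms satisfy the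
predicate `Q` (e.g. `Q` = "finitely generated", for the category of finitely presented
modules over a left coherent ring). -/
def qpdRel (Q : A → Prop) (M : A) : ℕ∞ :=
  if IsZero M then 0
  else sInf {d : ℕ∞ | ∃ (P : ChainComplex A ℤ) (s t : ℤ),
    IsFiniteQuasiProjRes M P ∧ (∀ i, Q (P.X i)) ∧ IsSup P s ∧ IsHSup P t ∧
    d = ((s - t).toNat : ℕ∞)}

/-- Projective dimension computed using only resolutions all of whose terms satisfy the
predicate `Q`. -/
def pdRel (Q : A → Prop) (M : A) : ℕ∞ :=
  sInf {d : ℕ∞ | ∃ n : ℕ, d = (n : ℕ∞) ∧ ∃ P : ChainComplex A ℤ,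
    (∀ i, Projective (P.X i)) ∧ (∀ i, Q (P.X i)) ∧
    (∀ i : ℤ, i < 0 → IsZero (P.X i)) ∧ (∀ i : ℤ, (n : ℤ) < i → IsZero (P.X i)) ∧
    (∀ i : ℤ, i ≠ 0 → IsZero (P.homology i)) ∧ Nonempty (P.homology 0 ≅ M)}

/-- Vanishing of the `n`-th Ext group, `Ext_𝒜^n(M, N) = 0`. -/
def extIsZero [EnoughProjectives A] (M N : A) (n : ℕ) : Prop :=
  IsZero (((_root_.Ext ℤ A n).obj (Opposite.op M)).obj N)

/-- The quasi-projective dimension of a finitely presented module over a (left coherent)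
ring, computed inside the abelian category of finitely presented modules, i.e. via bounded
complexes of finitely generated projective modules. -/
def qpdFG {R : Type u} [Ring R] (M : ModuleCat.{u} R) : ℕ∞ :=
  qpdRel (fun N : ModuleCat.{u} R => Module.Finite R N) M

/-- The projective dimension of a finitely presented module over a (left coherent) ring,
computed inside the abelian category of finitely presented modules. -/
def pdFG {R : Type u} [Ring R] (M : ModuleCat.{u} R) : ℕ∞ :=
  pdRel (fun N : ModuleCat.{u} R => Module.Finite R N) M

/-- A ring is left coherent if every finitely generated left ideal is finitely presented. -/
def IsLeftCoherent (R : Type u) [Ring R] : Prop :=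
  ∀ I : Ideal R, I.FG → Module.FinitePresentation R I

/-- The quasi-global dimension of a ring: the supremum of the quasi-projective dimensions
of all finitely generated left modules. -/
def qgldim (R : Type u) [Ring R] : ℕ∞ :=
  sSup {d : ℕ∞ | ∃ M : ModuleCat.{u} R, Module.Finite R M ∧ d = qpd M}

/-- The global dimension of a ring: the supremum of the projective dimensions of all
finitely generated left modules. -/
def gldim (R : Type u) [Ring R] : ℕ∞ :=
  sSup {d : ℕ∞ | ∃ M : ModuleCat.{u} R, Module.Finite R M ∧ d = pd M}

/-- The finitistic dimension of a ring: the supremum of the projective dimensions of all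
finitely generated left modules of finite projective dimension. -/
def findim (R : Type u) [Ring R] : ℕ∞ :=
  sSup {d : ℕ∞ | ∃ M : ModuleCat.{u} R, Module.Finite R M ∧ d = pd M ∧ pd M ≠ ⊤}

/-- The depth of a module over a Noetherian local ring:
`depth M = inf {i : Ext^i(R/𝔪, M) ≠ 0}`. -/
def depth {R : Type u} [CommRing R] [IsLocalRing R] (M : ModuleCat.{u} R) : ℕ∞ :=
  sInf {d : ℕ∞ | ∃ n : ℕ, d = (n : ℕ∞) ∧
    ¬ IsZero (((_root_.Ext ℤ (ModuleCat.{u} R) n).obj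
      (Opposite.op (ModuleCat.of R (IsLocalRing.ResidueField R)))).obj M)}

end QPD

end

namespace QPD

variable {A : Type*} [Category A] [Abelian A]

/-- The morphism `copies M n ⟶ copies N n` which is `f` on each summand. -/
noncomputable def copiesMap {M N : A} (f : M ⟶ N) (n : ℕ) : copies M n ⟶ copies N n :=
  biproduct.map fun _ => f

/-- The projection of `copies M n` onto its `j`-th summand. -/
noncomputable def copiesπ (M : A) {n : ℕ} (j : Fin n) : copies M n ⟶ M :=
  biproduct.π (fun _ => M) j

/-- The inclusion of the `j`-th summand of `copies M n`. -/
noncomputable def copiesι (M : A) {n : ℕ} (j : Fin n) : M ⟶ copies M n :=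
  biproduct.ι (fun _ => M) j

/-- The morphism to `copies M n` with given components. -/
noncomputable def copiesLift {M T : A} {n : ℕ} (k : Fin n → (T ⟶ M)) : T ⟶ copies M n :=
  biproduct.lift k

/-- The morphism from `copies M n` with given components. -/
noncomputable def copiesDesc {M T : A} {n : ℕ} (k : Fin n → (M ⟶ T)) : copies M n ⟶ T :=
  biproduct.desc k

@[simp]
lemma copiesι_π (M : A) {n : ℕ} (j : Fin n) : copiesι M j ≫ copiesπ M j = 𝟙 M :=
  biproduct.ι_π_self _ _

@[simp]
lemma copiesMap_π {M N : A} (f : M ⟶ N) {n : ℕ} (j : Fin n) :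
    copiesMap f n ≫ copiesπ N j = copiesπ M j ≫ f :=
  biproduct.map_π (fun _ : Fin n => f) j

@[simp]
lemma copiesMap_π_assoc {M N T : A} (f : M ⟶ N) {n : ℕ} (j : Fin n) (h : N ⟶ T) :
    copiesMap f n ≫ copiesπ N j ≫ h = copiesπ M j ≫ f ≫ h := by
  rw [← Category.assoc, copiesMap_π, Category.assoc]

@[simp]
lemma copiesLift_π {M T : A} {n : ℕ} (k : Fin n → (T ⟶ M)) (j : Fin n) :
    copiesLift k ≫ copiesπ M j = k j :=
  biproduct.lift_π _ _

@[simp]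
lemma copiesLift_π_assoc {M T Z : A} {n : ℕ} (k : Fin n → (T ⟶ M)) (j : Fin n) (h : M ⟶ Z) :
    copiesLift k ≫ copiesπ M j ≫ h = k j ≫ h := by
  rw [← Category.assoc, copiesLift_π]

@[simp]
lemma copiesι_desc {M T : A} {n : ℕ} (k : Fin n → (M ⟶ T)) (j : Fin n) :
    copiesι M j ≫ copiesDesc k = k j :=
  biproduct.ι_desc _ _

@[simp]
lemma copiesι_desc_assoc {M T Z : A} {n : ℕ} (k : Fin n → (M ⟶ T)) (j : Fin n) (h : T ⟶ Z) :
    copiesι M j ≫ copiesDesc k ≫ h = k j ≫ h := by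
  rw [← Category.assoc, copiesι_desc]

lemma copies_hom_ext {M T : A} {n : ℕ} {f g : T ⟶ copies M n}
    (h : ∀ j, f ≫ copiesπ M j = g ≫ copiesπ M j) : f = g :=
  biproduct.hom_ext _ _ h

lemma copies_hom_ext' {M T : A} {n : ℕ} {f g : copies M n ⟶ T}
    (h : ∀ j, copiesι M j ≫ f = copiesι M j ≫ g) : f = g :=
  biproduct.hom_ext' _ _ h

/-- Isomorphic objects have isomorphic direct sums of `n` copies. -/
noncomputable def copiesIso {M N : A} (e : M ≅ N) (n : ℕ) : copies M n ≅ copies N n :=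
  biproduct.mapIso fun _ => e

lemma isZero_copies_zero (M : A) : IsZero (copies M 0) := by
  rw [IsZero.iff_id_eq_zero]
  exact copies_hom_ext fun j => j.elim0

lemma isZero_copies {M : A} (hM : IsZero M) (n : ℕ) : IsZero (copies M n) := by
  rw [IsZero.iff_id_eq_zero]
  exact copies_hom_ext fun _ => hM.eq_of_tgt _ _

lemma isZero_of_isZero_copies {M : A} {n : ℕ} (hn : n ≠ 0) (h : IsZero (copies M n)) :
    IsZero M := by
  rw [IsZero.iff_id_eq_zero, ← copiesι_π M ⟨0, Nat.pos_of_ne_zero hn⟩,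
    h.eq_of_tgt (copiesι M _) 0, zero_comp]

instance projective_copies (P : A) [Projective P] (n : ℕ) : Projective (copies P n) where
  factors f e _ := ⟨copiesDesc fun j => Projective.factorThru (copiesι P j ≫ f) e,
    copies_hom_ext' fun j => by simp⟩

lemma shortExact_copies {S : ShortComplex A} (hS : S.ShortExact) (n : ℕ) :
    (ShortComplex.mk (copiesMap S.f n) (copiesMap S.g n)
      (copies_hom_ext fun j => by simp)).ShortExact := by
  have := hS.mono_f
  have := hS.epi_g
  have : Mono (copiesMap S.f n) := biproduct.map_mono fun _ : Fin n => S.f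
  have : Epi (copiesMap S.g n) := biproduct.map_epi fun _ : Fin n => S.g
  refine ShortComplex.ShortExact.mk (ShortComplex.exact_of_f_is_kernel _
    (KernelFork.IsLimit.ofι' _ _ fun {T} k hk => ?_))
  have hk' (j : Fin n) : (k ≫ copiesπ S.X₂ j) ≫ S.g = 0 := by
    simpa using hk =≫ copiesπ S.X₃ j
  exact ⟨copiesLift fun j => hS.exact.lift _ (hk' j), copies_hom_ext fun j => by simp⟩

lemma shortExact_opcycles (F : ChainComplex A ℤ) {i j : ℤ} (hij : j + 1 = i)
    (hF : IsZero (F.homology i)) :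
    (ShortComplex.mk (F.fromOpcycles i j) (F.pOpcycles j) (by
      rw [← cancel_epi (F.pOpcycles i)]; simp)).ShortExact where
  exact := by
    have h : (ComplexShape.down ℤ).prev j = i := (ComplexShape.down ℤ).prev_eq' hij
    have := ShortComplex.exact_of_g_is_cokernel
      (ShortComplex.mk (F.d i j) (F.pOpcycles j) (by simp)) (F.opcyclesIsCokernel i j h)
    rw [ShortComplex.exact_iff_epi_kernel_lift] at this
    rw [ShortComplex.exact_iff_epi_kernel_lift]
    dsimp at *
    refine @epi_of_epi_fac _ _ _ _ _ (F.pOpcycles i) _ _ this ?_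
    rw [← cancel_mono (kernel.ι _)]
    simp
  mono_f := by
    have h : (ComplexShape.down ℤ).next i = j := (ComplexShape.down ℤ).next_eq' hij
    have := (ShortComplex.exact_of_f_is_kernel
      (ShortComplex.mk (F.homologyι i) (F.fromOpcycles i j) (by simp)) (F.homologyIsKernel i j h))
    exact this.mono_g (hF.eq_of_src _ _)
  epi_g := inferInstanceAs (Epi (F.pOpcycles j))

lemma injective_opcycles (F : ChainComplex A ℤ) (hF : ∀ i, Injective (F.X i)) (b t : ℤ)
    (hb : ∀ i, b < i → IsZero (F.X i)) (ht : ∀ i, t < i → IsZero (F.homology i)) :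
    Injective (F.opcycles t) := by
  have key (n : ℕ) : ∀ i : ℤ, t ≤ i → b < i + n → Injective (F.opcycles i) := by
    induction n with
    | zero =>
      intro i _ hi
      have : IsZero (F.opcycles i) := by
        rw [IsZero.iff_id_eq_zero, ← cancel_epi (F.pOpcycles i)]
        exact (hb i (by simpa using hi)).eq_of_src _ _
      exact Injective.of_iso this.isoZero.symm inferInstance
    | succ n ih =>
      intro i hi hbi
      have h1 : Injective (F.opcycles (i + 1)) := ih (i + 1) (by lia) (by push_cast at hbi; lia)
      have hS := shortExact_opcycles F (i := i + 1) rfl (ht _ (by lia))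
      let s : (ShortComplex.mk _ _ _).Splitting := hS.splittingOfInjective
      have := hF i
      exact Retract.injective ⟨s.s, F.pOpcycles i, s.s_g⟩
  exact key (b - t + 1).toNat t le_rfl (by lia)

/-- The embedding `n ↦ t - n` of the natural numbers, seen as the degrees at most `t`. -/
def embeddingDownIntLE (t : ℤ) : (ComplexShape.up ℕ).Embedding (ComplexShape.down ℤ) :=
  ComplexShape.Embedding.mk' _ _ (fun n : ℕ => t - (n : ℤ))
    (fun _ _ h => by dsimp at h; lia)
    (fun _ _ => by simp only [ComplexShape.up_Rel, ComplexShape.down_Rel]; lia)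

instance (t : ℤ) : (embeddingDownIntLE t).IsTruncGE where
  rel' i j h := by
    simp only [embeddingDownIntLE, ComplexShape.Embedding.mk', ComplexShape.down_Rel] at h
    simp only [ComplexShape.up_Rel]
    lia
  mem_next {j k} h := by
    simp only [embeddingDownIntLE, ComplexShape.Embedding.mk', ComplexShape.down_Rel] at h ⊢
    exact ⟨j + 1, by push_cast; lia⟩

lemma embeddingDownIntLE_f (t : ℤ) (n : ℕ) : (embeddingDownIntLE t).f n = t - n := rfl

lemma boundaryGE_embeddingDownIntLE_iff (t : ℤ) (n : ℕ) :
    (embeddingDownIntLE t).BoundaryGE n ↔ n = 0 := by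
  simp only [ComplexShape.Embedding.BoundaryGE, embeddingDownIntLE_f, ChainComplex.prev,
    ComplexShape.down_Rel, true_and]
  constructor
  · intro h
    by_contra hn
    exact h (n - 1) (by lia)
  · rintro rfl i
    lia

/-- `M` admits a finite quasi-projective resolution. -/
def HasFiniteQuasiProjRes (M : A) : Prop := ∃ F : ChainComplex A ℤ, IsFiniteQuasiProjRes M F

lemma exists_isHSup {M : A} (hM : ¬ IsZero M) {F : ChainComplex A ℤ}
    (hF : IsFiniteQuasiProjRes M F) : ∃ t, IsHSup F t := by
  obtain ⟨b, hb⟩ := hF.bddAbove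
  obtain ⟨mult, ⟨j, hj⟩, hm⟩ := hF.homology_iso
  have hj' : ¬ IsZero (F.homology j) := by
    intro h
    apply hM
    exact isZero_of_isZero_copies hj (h.of_iso (hm j).some.symm)
  have hb' (i : ℤ) (hi : ¬ IsZero (F.homology i)) : i ≤ b := by
    by_contra h
    exact hi (ShortComplex.exact_iff_isZero_homology _ |>.1
      (ShortComplex.exact_of_isZero_X₂ _ (hb i (by lia))))
  obtain ⟨t, ht, hmax⟩ := Int.exists_greatest_of_bdd
    (P := fun i => ¬ IsZero (F.homology i)) ⟨b, hb'⟩ ⟨j, hj'⟩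
  exact ⟨t, ht, fun i hi => by_contra fun h => absurd (hmax i h) (by lia)⟩

open HomologicalComplex in
lemma qpd_eq_zero (hfrob : ∀ X : A, Projective X ↔ Injective X) {M : A}
    (h : HasFiniteQuasiProjRes M) : qpd M = 0 := by
  unfold qpd
  split_ifs with hM
  · rfl
  obtain ⟨F, hF⟩ := h
  obtain ⟨t, ht⟩ := exists_isHSup hM hF
  obtain ⟨a, ha⟩ := hF.bddBelow
  obtain ⟨b, hb⟩ := hF.bddAbove
  obtain ⟨mult, hmult, hm⟩ := hF.homology_iso
  let e := embeddingDownIntLE t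
  let G : ChainComplex A ℤ := F.truncGE e
  have hsupp : F.IsSupported e := ⟨fun i hi => by
    rw [exactAt_iff_isZero_homology]
    apply ht.2
    by_contra hti
    exact hi (t - i).toNat (by rw [embeddingDownIntLE_f]; lia)⟩
  have hq : QuasiIso (F.πTruncGE e) := (F.quasiIso_πTruncGE_iff_isSupported e).2 hsupp
  have isoH (i : ℤ) : F.homology i ≅ G.homology i := asIso (homologyMap (F.πTruncGE e) i)
  have hGt (i : ℤ) (hi : t < i) : IsZero (G.X i) := by
    apply isZero_extend_X
    intro n
    rw [embeddingDownIntLE_f]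
    lia
  have isoX (i : ℤ) (hi : i < t) : G.X i ≅ F.X i :=
    F.truncGEXIso e (i := (t - i).toNat) (by rw [embeddingDownIntLE_f]; lia)
      (by rw [boundaryGE_embeddingDownIntLE_iff]; lia)
  have isot : G.X t ≅ F.opcycles t :=
    F.truncGEXIsoOpcycles e (i := 0) (by rw [embeddingDownIntLE_f]; simp)
      (by rw [boundaryGE_embeddingDownIntLE_iff])
  have hop : Projective (F.opcycles t) := (hfrob _).2
    (injective_opcycles F (fun i => (hfrob _).1 (hF.projective i)) b t hb ht.2)
  refine le_antisymm (sInf_le ⟨G, t, t, ⟨⟨fun i => ?_, ⟨min a t, fun i hi => ?_⟩, mult, hmult,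
    fun j => ⟨(isoH j).symm ≪≫ (hm j).some⟩⟩, t, hGt⟩, ⟨fun h0 => ht.1 ?_, hGt⟩,
    ⟨fun h0 => ht.1 (h0.of_iso (isoH t)), fun i hi => (ht.2 i hi).of_iso (isoH i).symm⟩,
    by simp⟩) bot_le
  · rcases lt_trichotomy i t with hi | rfl | hi
    · exact Projective.of_iso (isoX i hi).symm (hF.projective i)
    · exact Projective.of_iso isot.symm hop
    · exact Projective.of_iso (hGt i hi).isoZero.symm inferInstance
  · exact (ha i (by lia)).of_iso (isoX i (by lia))
  · exact IsZero.of_mono (F.homologyι t) (h0.of_iso isot.symm)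

open ZeroObject in
lemma qpd_eq_top {M : A} (h : ¬ HasFiniteQuasiProjRes M) : qpd M = ⊤ := by
  unfold qpd
  split_ifs with hM
  · have hX (i : ℤ) : IsZero ((0 : ChainComplex A ℤ).X i) :=
      (HomologicalComplex.eval A _ i).map_isZero (isZero_zero _)
    refine (h ⟨0, ⟨fun i => ?_, ⟨0, fun i _ => hX i⟩, fun _ => 1, ⟨0, one_ne_zero⟩,
      fun j => ⟨IsZero.iso ?_ (isZero_copies hM 1)⟩⟩, 0, fun i _ => hX i⟩).elim
    · exact Projective.of_iso (hX i).isoZero.symm inferInstance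
    · exact ShortComplex.exact_iff_isZero_homology _ |>.1
        (ShortComplex.exact_of_isZero_X₂ _ (hX j))
  · rw [sInf_eq_top]
    rintro _ ⟨F, -, -, hF, -⟩
    exact (h ⟨F, hF⟩).elim

lemma qpd_congr (hfrob : ∀ X : A, Projective X ↔ Injective X) {M N : A}
    (h : HasFiniteQuasiProjRes M ↔ HasFiniteQuasiProjRes N) : qpd M = qpd N := by
  by_cases hM : HasFiniteQuasiProjRes M
  · rw [qpd_eq_zero hfrob hM, qpd_eq_zero hfrob (h.1 hM)]
  · rw [qpd_eq_top hM, qpd_eq_top (mt h.2 hM)]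

open HomologicalComplex

lemma exists_complex_d_eq_zero (E : ℤ → A) :
    ∃ (L : ChainComplex A ℤ) (_ : ∀ i, L.X i ≅ E i), ∀ i j, L.d i j = 0 :=
  ⟨{ X := E, d := fun _ _ => 0 }, fun _ => Iso.refl _, fun _ _ => rfl⟩

/-- The homology of a complex with zero differentials. -/
noncomputable def homologyIsoX (L : ChainComplex A ℤ) (hL : ∀ i j, L.d i j = 0) (i : ℤ) :
    L.homology i ≅ L.X i :=
  (L.isoHomologyπ (i + 1) i (by simp) (hL _ _)).symm ≪≫ L.iCyclesIso i (i - 1) (by simp) (hL _ _)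

@[simp]
lemma homologyπ_homologyIsoX_hom (L : ChainComplex A ℤ) (hL : ∀ i j, L.d i j = 0) (i : ℤ) :
    L.homologyπ i ≫ (homologyIsoX L hL i).hom = L.iCycles i :=
  L.isoHomologyπ_hom_inv_id_assoc (i + 1) i (by simp) (hL _ _) (L.iCycles i)

/-- The extension of `L` by `K` with `K.X i ⊞ L.X i` in degree `i`, and with differential
twisted by `ψ`. -/
@[simps]
noncomputable def twistedBiprod (K L : ChainComplex A ℤ) (ψ : ∀ i j, L.X i ⟶ K.X j)
    (hψ : ∀ i j, j + 1 ≠ i → ψ i j = 0)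
    (hd : ∀ i j k, ψ i j ≫ K.d j k + L.d i j ≫ ψ j k = 0) : ChainComplex A ℤ where
  X i := K.X i ⊞ L.X i
  d i j := biprod.desc (K.d i j ≫ biprod.inl) (ψ i j ≫ biprod.inl + L.d i j ≫ biprod.inr)
  shape i j h := by
    rw [K.shape _ _ h, L.shape _ _ h, hψ _ _ h]
    apply biprod.hom_ext' <;> simp
  d_comp_d' i j k _ _ := by
    apply biprod.hom_ext'
    · simp
    · simpa using (hd i j k) =≫ biprod.inl

section

variable (K L : ChainComplex A ℤ) (ψ : ∀ i j, L.X i ⟶ K.X j)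
  (hψ : ∀ i j, j + 1 ≠ i → ψ i j = 0)
  (hd : ∀ i j k, ψ i j ≫ K.d j k + L.d i j ≫ ψ j k = 0)

lemma inl_twistedBiprod_d (i j : ℤ) :
    (biprod.inl : K.X i ⟶ K.X i ⊞ L.X i) ≫ (twistedBiprod K L ψ hψ hd).d i j =
      K.d i j ≫ biprod.inl :=
  biprod.inl_desc _ _

lemma inr_twistedBiprod_d (i j : ℤ) :
    (biprod.inr : L.X i ⟶ K.X i ⊞ L.X i) ≫ (twistedBiprod K L ψ hψ hd).d i j =
      ψ i j ≫ biprod.inl + L.d i j ≫ biprod.inr :=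
  biprod.inr_desc _ _

lemma twistedBiprod_d_snd (i j : ℤ) :
    (biprod.snd : K.X i ⊞ L.X i ⟶ L.X i) ≫ L.d i j =
      (twistedBiprod K L ψ hψ hd).d i j ≫ (biprod.snd : K.X j ⊞ L.X j ⟶ L.X j) := by
  change _ = biprod.desc (K.d i j ≫ biprod.inl) (ψ i j ≫ biprod.inl + L.d i j ≫ biprod.inr) ≫
    biprod.snd
  apply biprod.hom_ext' <;> simp

/-- The short exact sequence `K ⟶ twistedBiprod K L ψ ⟶ L`. -/
@[simps]
noncomputable def twistedBiprodShortComplex : ShortComplex (ChainComplex A ℤ) where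
  X₁ := K
  X₂ := twistedBiprod K L ψ hψ hd
  X₃ := L
  f := { f := fun _ => biprod.inl
         comm' := fun i j _ => inl_twistedBiprod_d K L ψ hψ hd i j }
  g := { f := fun _ => biprod.snd
         comm' := fun i j _ => twistedBiprod_d_snd K L ψ hψ hd i j }
  zero := by
    ext i
    exact biprod.inl_snd

lemma shortExact_twistedBiprod : (twistedBiprodShortComplex K L ψ hψ hd).ShortExact := by
  apply shortExact_of_degreewise_shortExact
  intro i
  exact (ShortComplex.Splitting.ofHasBinaryBiproduct (K.X i) (L.X i)).shortExact

/-- The connecting morphism of the short exact sequence `K ⟶ twistedBiprod K L ψ ⟶ L`. -/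
noncomputable def twistedBiprodδ (i j : ℤ) (hij : (ComplexShape.down ℤ).Rel i j) :
    L.homology i ⟶ K.homology j :=
  (shortExact_twistedBiprod K L ψ hψ hd).δ i j hij

lemma comp_twistedBiprodδ {i j : ℤ} (hij : (ComplexShape.down ℤ).Rel i j) {T : A} (x : T ⟶ L.X i)
    (hx : x ≫ L.d i j = 0) (y : T ⟶ K.cycles j) (hy : y ≫ K.iCycles j = x ≫ ψ i j) :
    L.liftCycles x j ((ComplexShape.down ℤ).next_eq' hij) hx ≫ L.homologyπ i ≫
      twistedBiprodδ K L ψ hψ hd i j hij = y ≫ K.homologyπ j := by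
  have h₂ : (x ≫ biprod.inr) ≫ (biprod.snd : K.X i ⊞ L.X i ⟶ L.X i) = x := by simp
  have h₁ : (x ≫ ψ i j) ≫ (biprod.inl : K.X j ⟶ K.X j ⊞ L.X j) =
      (x ≫ (biprod.inr : L.X i ⟶ K.X i ⊞ L.X i)) ≫ (twistedBiprod K L ψ hψ hd).d i j := by
    have h := x ≫= inr_twistedBiprod_d K L ψ hψ hd i j
    have h' : (x ≫ ψ i j) ≫ (biprod.inl : K.X j ⟶ K.X j ⊞ L.X j) =
        x ≫ (ψ i j ≫ biprod.inl + L.d i j ≫ biprod.inr) := by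
      rw [Preadditive.comp_add, ← Category.assoc x (L.d i j), hx, zero_comp, add_zero,
        Category.assoc]
    exact h'.trans (h.symm.trans (Category.assoc _ _ _).symm)
  have := (shortExact_twistedBiprod K L ψ hψ hd).δ_eq i j hij x hx (x ≫ biprod.inr) h₂
    (x ≫ ψ i j) h₁ _ rfl
  have h₃ (h) : K.liftCycles (x ≫ ψ i j) _ rfl h = y := by
    rw [← cancel_mono (K.iCycles j), hy, K.liftCycles_i]
  exact this.trans (congrArg (· ≫ K.homologyπ j) (h₃ _))

lemma twistedBiprodδ_of_d_right_eq_zero (hL : ∀ i j, L.d i j = 0) {i j : ℤ}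
    (hij : (ComplexShape.down ℤ).Rel i j) (y : L.X i ⟶ K.cycles j)
    (hy : y ≫ K.iCycles j = ψ i j) :
    twistedBiprodδ K L ψ hψ hd i j hij =
      (homologyIsoX L hL i).hom ≫ y ≫ K.homologyπ j := by
  have h := comp_twistedBiprodδ K L ψ hψ hd hij (𝟙 (L.X i)) (by rw [hL, comp_zero]) y
    (hy.trans (Category.id_comp _).symm)
  rw [← h, ← cancel_epi (L.homologyπ i), ← Category.assoc (L.homologyπ i) _ (_ ≫ _),
    homologyπ_homologyIsoX_hom]
  have h' : L.iCycles i ≫ L.liftCycles (𝟙 (L.X i)) j ((ComplexShape.down ℤ).next_eq' hij)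
      (by rw [hL, comp_zero]) = 𝟙 _ := by
    rw [← cancel_mono (L.iCycles i)]
    simp
  rw [← Category.assoc, h', Category.id_comp]

lemma homologyπ_twistedBiprodδ_of_d_left_eq_zero (hK : ∀ i j, K.d i j = 0) {i j : ℤ}
    (hij : (ComplexShape.down ℤ).Rel i j) :
    L.homologyπ i ≫ twistedBiprodδ K L ψ hψ hd i j hij ≫ (homologyIsoX K hK j).hom =
      L.iCycles i ≫ ψ i j := by
  have hd' : (L.iCycles i ≫ ψ i j) ≫ K.d j (j - 1) = 0 := by rw [hK, comp_zero]
  have h := comp_twistedBiprodδ K L ψ hψ hd hij (L.iCycles i) (by simp)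
    (K.liftCycles (L.iCycles i ≫ ψ i j) (j - 1) (by simp) hd') (K.liftCycles_i _ _ _ _)
  have h₁ : L.liftCycles (L.iCycles i) j ((ComplexShape.down ℤ).next_eq' hij) (by simp) = 𝟙 _ := by
    rw [← cancel_mono (L.iCycles i)]
    simp
  rw [h₁, Category.id_comp] at h
  rw [← Category.assoc, h, Category.assoc, homologyπ_homologyIsoX_hom, K.liftCycles_i]

end

/-- If a connecting morphism is an epimorphism and the next one is the epimorphism of a short
exact sequence `T`, then the homology of the middle complex is the kernel in `T`. -/
lemma nonempty_iso_homology_of_epi_δ {S : ShortComplex (ChainComplex A ℤ)} (hS : S.ShortExact)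
    {i j k : ℤ} (hij : (ComplexShape.down ℤ).Rel i j) (hjk : (ComplexShape.down ℤ).Rel j k)
    (h : Epi (hS.δ i j hij)) {T : ShortComplex A} (hT : T.ShortExact)
    (e₂ : S.X₃.homology j ≅ T.X₂) (e₃ : S.X₁.homology k ≅ T.X₃)
    (comm : e₂.hom ≫ T.g = hS.δ j k hjk ≫ e₃.hom) :
    Nonempty (S.X₂.homology j ≅ T.X₁) := by
  have h0 : homologyMap S.f j = 0 := by
    rw [← cancel_epi (hS.δ i j hij)]
    simp
  have : Mono (homologyMap S.g j) := (hS.homology_exact₂ j).mono_g h0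
  have := hT.mono_f
  have w : (homologyMap S.g j ≫ e₂.hom) ≫ T.g = 0 := by
    rw [Category.assoc, comm, hS.comp_δ_assoc, zero_comp]
  have hex : (ShortComplex.mk _ _ w).Exact :=
    ShortComplex.exact_of_iso (S₁ := ShortComplex.mk _ _ (hS.comp_δ j k hjk))
      (ShortComplex.isoMk (Iso.refl _) e₂ e₃ (Category.id_comp _) comm) (hS.homology_exact₃ j k hjk)
  have : Mono (ShortComplex.mk _ _ w).f := inferInstanceAs (Mono (homologyMap S.g j ≫ e₂.hom))
  exact ⟨IsLimit.conePointUniqueUpToIso hex.fIsKernel hT.fIsKernel⟩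

/-- If a connecting morphism is a monomorphism and the previous one is the monomorphism of a
short exact sequence `T`, then the homology of the middle complex is the cokernel in `T`. -/
lemma nonempty_iso_homology_of_mono_δ {S : ShortComplex (ChainComplex A ℤ)} (hS : S.ShortExact)
    {i j k : ℤ} (hij : (ComplexShape.down ℤ).Rel i j) (hjk : (ComplexShape.down ℤ).Rel j k)
    (h : Mono (hS.δ j k hjk)) {T : ShortComplex A} (hT : T.ShortExact)
    (e₁ : S.X₃.homology i ≅ T.X₁) (e₂ : S.X₁.homology j ≅ T.X₂)
    (comm : e₁.hom ≫ T.f = hS.δ i j hij ≫ e₂.hom) :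
    Nonempty (S.X₂.homology j ≅ T.X₃) := by
  have h0 : homologyMap S.g j = 0 := by
    rw [← cancel_mono (hS.δ j k hjk)]
    simp
  have : Epi (homologyMap S.f j) := (hS.homology_exact₂ j).epi_f h0
  have := hT.epi_g
  have comm' : e₂.hom ≫ e₂.inv ≫ homologyMap S.f j = homologyMap S.f j ≫ 𝟙 _ := by simp
  have w : T.f ≫ e₂.inv ≫ homologyMap S.f j = 0 := by
    rw [← cancel_epi e₁.hom, ← Category.assoc, comm, Category.assoc, e₂.hom_inv_id_assoc,
      hS.δ_comp, comp_zero]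
  have hex : (ShortComplex.mk _ _ w).Exact :=
    ShortComplex.exact_of_iso (S₁ := ShortComplex.mk _ _ (hS.δ_comp i j hij))
      (ShortComplex.isoMk e₁ e₂ (Iso.refl _) comm comm') (hS.homology_exact₁ i j hij)
  have : Epi (ShortComplex.mk _ _ w).g := inferInstanceAs (Epi (e₂.inv ≫ homologyMap S.f j))
  exact ⟨IsColimit.coconePointUniqueUpToIso hex.gIsCokernel hT.gIsCokernel⟩

lemma HasFiniteQuasiProjRes.of_iso {M N : A} (e : M ≅ N) (h : HasFiniteQuasiProjRes M) :
    HasFiniteQuasiProjRes N := by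
  obtain ⟨F, ⟨hp, hb, mult, hmult, hm⟩, ha⟩ := h
  exact ⟨F, ⟨hp, hb, mult, hmult, fun j => ⟨(hm j).some ≪≫ copiesIso e _⟩⟩, ha⟩

/-- The multiplicities of a finite quasi-projective resolution can be chosen to have bounded
support. -/
lemma IsFiniteQuasiProjRes.exists_bounded_mult {M : A} {F : ChainComplex A ℤ}
    (hF : IsFiniteQuasiProjRes M F) : ∃ (a b : ℤ) (mult : ℤ → ℕ), (∃ j, mult j ≠ 0) ∧
      (∀ j, Nonempty (F.homology j ≅ copies M (mult j))) ∧
      ∀ i, i < a ∨ b < i → IsZero (F.X i) ∧ mult i = 0 := by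
  obtain ⟨a, ha⟩ := hF.bddBelow
  obtain ⟨b, hb⟩ := hF.bddAbove
  obtain ⟨mult, ⟨j₀, hj₀⟩, hm⟩ := hF.homology_iso
  have hX (i : ℤ) (hi : i < min a j₀ ∨ max b j₀ < i) : IsZero (F.X i) :=
    hi.elim (fun h => ha i (by lia)) (fun h => hb i (by lia))
  refine ⟨min a j₀, max b j₀, fun j => if j < min a j₀ ∨ max b j₀ < j then 0 else mult j,
    ⟨j₀, ?_⟩, fun j => ?_, fun i hi => ⟨hX i hi, if_pos hi⟩⟩
  · dsimp only
    rwa [if_neg (by lia)]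
  · dsimp only
    split_ifs with h
    · exact ⟨IsZero.iso (ShortComplex.exact_iff_isZero_homology _ |>.1
        (ShortComplex.exact_of_isZero_X₂ _ (hX j h))) (isZero_copies_zero M)⟩
    · exact hm j

lemma hasFiniteQuasiProjRes_twistedBiprod {M : A} {K L : ChainComplex A ℤ}
    {ψ : ∀ i j, L.X i ⟶ K.X j} {hψ : ∀ i j, j + 1 ≠ i → ψ i j = 0}
    {hd : ∀ i j k, ψ i j ≫ K.d j k + L.d i j ≫ ψ j k = 0}
    (hK : ∀ i, Projective (K.X i)) (hL : ∀ i, Projective (L.X i)) (a b : ℤ)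
    (hz : ∀ i, i < a ∨ b < i → IsZero (K.X i) ∧ IsZero (L.X i))
    (mult : ℤ → ℕ) (hmult : ∃ j, mult j ≠ 0)
    (h : ∀ j, Nonempty ((twistedBiprod K L ψ hψ hd).homology j ≅ copies M (mult j))) :
    HasFiniteQuasiProjRes M := by
  have hzero (i : ℤ) (hi : i < a ∨ b < i) : IsZero (K.X i ⊞ L.X i) := by
    rw [IsZero.iff_id_eq_zero]
    exact biprod.hom_ext _ _ ((hz i hi).1.eq_of_tgt _ _) ((hz i hi).2.eq_of_tgt _ _)
  exact ⟨twistedBiprod K L ψ hψ hd,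
    ⟨fun i => inferInstanceAs (Projective (K.X i ⊞ L.X i)), ⟨a, fun i hi => hzero i (.inl hi)⟩,
      mult, hmult, h⟩, b, fun i hi => hzero i (.inr hi)⟩

lemma HasFiniteQuasiProjRes.of_shortExact {S : ShortComplex A} (hS : S.ShortExact)
    (hP : Projective S.X₂) (h : HasFiniteQuasiProjRes S.X₃) : HasFiniteQuasiProjRes S.X₁ := by
  obtain ⟨F, hF⟩ := h
  obtain ⟨a, b, mult, ⟨j₀, hj₀⟩, hm, hz⟩ := hF.exists_bounded_mult
  obtain ⟨m, rfl⟩ : ∃ m : ℤ → ℕ, mult = fun j => m (j + 1) :=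
    ⟨fun i => mult (i - 1), funext fun j => by simp⟩
  have hT (i : ℤ) := shortExact_copies hS (m i)
  obtain ⟨E, eE, hE⟩ := exists_complex_d_eq_zero fun i => copies S.X₂ (m i)
  have hEproj (i : ℤ) : Projective (E.X i) := Projective.of_iso (eE i).symm inferInstance
  have hψ (i j : ℤ) : ∃ ψ : E.X i ⟶ F.X j, (j + 1 ≠ i → ψ = 0) ∧
      (∀ k, ψ ≫ F.d j k = 0) ∧ ∀ _ : j + 1 = i, ∃ (y : E.X i ⟶ F.cycles j)
        (e : F.homology j ≅ copies S.X₃ (m i)), y ≫ F.iCycles j = ψ ∧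
          y ≫ F.homologyπ j ≫ e.hom = (eE i).hom ≫ copiesMap S.g (m i) := by
    by_cases hij : j + 1 = i
    · subst hij
      obtain ⟨e⟩ := hm j
      refine ⟨Projective.factorThru ((eE _).hom ≫ copiesMap S.g _) (F.homologyπ j ≫ e.hom) ≫
        F.iCycles j, fun h => (h rfl).elim, fun k => ?_, fun _ => ⟨_, e, rfl,
        Projective.factorThru_comp _ _⟩⟩
      rw [Category.assoc, F.iCycles_d, comp_zero]
    · exact ⟨0, fun _ => rfl, fun k => zero_comp, fun h => (hij h).elim⟩
  choose ψ hψ₀ hψd hψ using hψ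
  have hd (i j k : ℤ) : ψ i j ≫ F.d j k + E.d i j ≫ ψ j k = 0 := by
    rw [hψd, hE, zero_comp, add_zero]
  have hex := shortExact_twistedBiprod F E ψ hψ₀ hd
  have hδ (i j : ℤ) (hij : (ComplexShape.down ℤ).Rel i j) :
      ∃ e : F.homology j ≅ copies S.X₃ (m i),
        (homologyIsoX E hE i ≪≫ eE i).hom ≫ copiesMap S.g (m i) =
          twistedBiprodδ F E ψ hψ₀ hd i j hij ≫ e.hom := by
    obtain ⟨y, e, hy, he⟩ := hψ i j hij
    refine ⟨e, ?_⟩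
    have h := twistedBiprodδ_of_d_right_eq_zero F E ψ hψ₀ hd hE hij y hy =≫ e.hom
    rw [Category.assoc, Category.assoc, he] at h
    exact (Category.assoc _ _ _).trans h.symm
  have hrel (j : ℤ) : (ComplexShape.down ℤ).Rel (j + 1) j := rfl
  refine hasFiniteQuasiProjRes_twistedBiprod hF.projective hEproj a (b + 1) (fun i hi => ?_)
    m ⟨_, hj₀⟩ (fun j => ?_) (ψ := ψ) (hψ := hψ₀) (hd := hd)
  · refine ⟨(hz i (by lia)).1, ?_⟩
    have hi' : m i = 0 := by simpa using (hz (i - 1) (by lia)).2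
    exact (hi' ▸ isZero_copies_zero S.X₂ : IsZero (copies S.X₂ (m i))).of_iso (eE i)
  · obtain ⟨e, he⟩ := hδ (j + 1) j (hrel j)
    have hepi : Epi (twistedBiprodδ F E ψ hψ₀ hd _ _ (hrel j)) := by
      have : Epi (copiesMap S.g (m (j + 1))) := (hT (j + 1)).epi_g
      have : twistedBiprodδ F E ψ hψ₀ hd _ _ (hrel j) = _ := (Iso.comp_inv_eq e |>.2 he).symm
      rw [this]
      infer_instance
    have hrel' : (ComplexShape.down ℤ).Rel j (j - 1) := by simp
    obtain ⟨e', he'⟩ := hδ j (j - 1) hrel'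
    exact nonempty_iso_homology_of_epi_δ hex (hrel j) hrel' hepi (hT j)
      (homologyIsoX E hE j ≪≫ eE j) e' he'

lemma HasFiniteQuasiProjRes.of_shortExact' (hfrob : ∀ X : A, Projective X ↔ Injective X)
    {S : ShortComplex A} (hS : S.ShortExact) (hP : Projective S.X₂)
    (h : HasFiniteQuasiProjRes S.X₁) : HasFiniteQuasiProjRes S.X₃ := by
  obtain ⟨F, hF⟩ := h
  obtain ⟨a, b, mult, ⟨j₀, hj₀⟩, hm, hz⟩ := hF.exists_bounded_mult
  let m (j : ℤ) : ℕ := mult (j + 1)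
  have hT (i : ℤ) := shortExact_copies hS (m i)
  obtain ⟨E, eE, hE⟩ := exists_complex_d_eq_zero fun i => copies S.X₂ (m i)
  have hEproj (i : ℤ) : Projective (E.X i) := Projective.of_iso (eE i).symm inferInstance
  have hψ (i j : ℤ) : ∃ ψ : F.X i ⟶ E.X j, (j + 1 ≠ i → ψ = 0) ∧
      (∀ k, F.d k i ≫ ψ = 0) ∧ ∀ _ : j + 1 = i, ∃ e : F.homology i ≅ copies S.X₁ (m j),
        F.iCycles i ≫ ψ ≫ (eE j).hom = F.homologyπ i ≫ e.hom ≫ copiesMap S.f (m j) := by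
    by_cases hij : j + 1 = i
    · subst hij
      obtain ⟨e⟩ : Nonempty (F.homology (j + 1) ≅ copies S.X₁ (m j)) := hm (j + 1)
      have := (hfrob _).1 (hEproj j)
      refine ⟨F.pOpcycles _ ≫ Injective.factorThru (e.hom ≫ copiesMap S.f _ ≫ (eE j).inv)
        (F.homologyι _), fun h => (h rfl).elim, fun k => ?_, fun _ => ⟨e, ?_⟩⟩
      · rw [F.d_pOpcycles_assoc, zero_comp]
      · rw [Category.assoc, ← F.homology_π_ι_assoc, Injective.comp_factorThru_assoc,
          Category.assoc, Category.assoc, Iso.inv_hom_id, Category.comp_id]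
    · exact ⟨0, fun _ => rfl, fun k => comp_zero, fun h => (hij h).elim⟩
  choose ψ hψ₀ hψd hψ using hψ
  have hd (i j k : ℤ) : ψ i j ≫ E.d j k + F.d i j ≫ ψ j k = 0 := by
    rw [hψd, hE, comp_zero, add_zero]
  have hex := shortExact_twistedBiprod E F ψ hψ₀ hd
  have hδ (i j : ℤ) (hij : (ComplexShape.down ℤ).Rel i j) :
      ∃ e : F.homology i ≅ copies S.X₁ (m j), e.hom ≫ copiesMap S.f (m j) =
        twistedBiprodδ E F ψ hψ₀ hd i j hij ≫ (homologyIsoX E hE j ≪≫ eE j).hom := by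
    obtain ⟨e, he⟩ := hψ i j hij
    refine ⟨e, ?_⟩
    rw [← cancel_epi (F.homologyπ i), ← he, Iso.trans_hom]
    have h := homologyπ_twistedBiprodδ_of_d_left_eq_zero E F ψ hψ₀ hd hE hij =≫ (eE j).hom
    simpa using h.symm
  have hrel (j : ℤ) : (ComplexShape.down ℤ).Rel j (j - 1) := by simp
  refine hasFiniteQuasiProjRes_twistedBiprod hEproj hF.projective (a - 1) b (fun i hi => ?_)
    m ⟨j₀ - 1, by simpa [m] using hj₀⟩ (fun j => ?_) (ψ := ψ) (hψ := hψ₀) (hd := hd)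
  · refine ⟨?_, (hz i (by lia)).1⟩
    have hi' : m i = 0 := (hz (i + 1) (by lia)).2
    exact (hi' ▸ isZero_copies_zero S.X₂ : IsZero (copies S.X₂ (m i))).of_iso (eE i)
  · obtain ⟨e, he⟩ := hδ j (j - 1) (hrel j)
    have hmono : Mono (twistedBiprodδ E F ψ hψ₀ hd _ _ (hrel j)) := by
      have : Mono (copiesMap S.f (m (j - 1))) := (hT (j - 1)).mono_f
      exact mono_of_mono_fac he.symm
    have hrel' : (ComplexShape.down ℤ).Rel (j + 1) j := rfl
    obtain ⟨e', he'⟩ := hδ (j + 1) j hrel'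
    exact nonempty_iso_homology_of_mono_δ hex hrel' (hrel j) hmono (hT j) e'
      (homologyIsoX E hE j ≪≫ eE j) he'

lemma hasFiniteQuasiProjRes_iff_of_shortExact (hfrob : ∀ X : A, Projective X ↔ Injective X)
    {S : ShortComplex A} (hS : S.ShortExact) (hP : Projective S.X₂) :
    HasFiniteQuasiProjRes S.X₃ ↔ HasFiniteQuasiProjRes S.X₁ :=
  ⟨.of_shortExact hS hP, .of_shortExact' hfrob hS hP⟩

lemma hasFiniteQuasiProjRes_biprod_iff [EnoughProjectives A]
    (hfrob : ∀ X : A, Projective X ↔ Injective X) (M P : A) [Projective P] :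
    HasFiniteQuasiProjRes (M ⊞ P) ↔ HasFiniteQuasiProjRes M := by
  have hS : (ShortComplex.mk (kernel.ι (Projective.π M)) (Projective.π M)
      (kernel.condition _)).ShortExact :=
    { exact := ShortComplex.exact_of_f_is_kernel _ (kernelIsKernel _) }
  have hS' : (ShortComplex.mk
      (kernel.ι (Projective.π M) ≫ (biprod.inl : _ ⟶ Projective.over M ⊞ P))
      (biprod.map (Projective.π M) (𝟙 P)) (by simp)).ShortExact :=
    { exact := ShortComplex.exact_of_f_is_kernel _ (KernelFork.IsLimit.ofι' _ _ fun {T} k hk => by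
        have h₁ := hk =≫ biprod.fst
        have h₂ := hk =≫ biprod.snd
        simp only [Category.assoc, biprod.map_fst, biprod.map_snd, Category.comp_id,
          zero_comp] at h₁ h₂
        exact ⟨kernel.lift _ (k ≫ biprod.fst) (by simpa using h₁),
          biprod.hom_ext _ _ (by simp) (by simp [h₂])⟩)
      mono_f := inferInstanceAs (Mono (kernel.ι (Projective.π M) ≫ biprod.inl))
      epi_g := inferInstanceAs (Epi (biprod.map (Projective.π M) (𝟙 P))) }
  exact (hasFiniteQuasiProjRes_iff_of_shortExact hfrob hS'
    (inferInstanceAs (Projective (Projective.over M ⊞ P)))).trans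
    (hasFiniteQuasiProjRes_iff_of_shortExact hfrob hS
      (inferInstanceAs (Projective (Projective.over M)))).symm

lemma hasFiniteQuasiProjRes_iff_of_iso {M N : A} (e : M ≅ N) :
    HasFiniteQuasiProjRes M ↔ HasFiniteQuasiProjRes N :=
  ⟨.of_iso e, .of_iso e.symm⟩

lemma hasFiniteQuasiProjRes_opcycles_iff (hfrob : ∀ X : A, Projective X ↔ Injective X) {M : A}
    (Q : ChainComplex A ℤ) (hQproj : ∀ j, Projective (Q.X j))
    (hQneg : ∀ j : ℤ, j < 0 → IsZero (Q.X j)) (hQres : ∀ j : ℤ, j ≠ 0 → IsZero (Q.homology j))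
    (hQ0 : Nonempty (Q.homology 0 ≅ M)) (n : ℕ) :
    HasFiniteQuasiProjRes (Q.opcycles n) ↔ HasFiniteQuasiProjRes M := by
  induction n with
  | zero =>
    exact hasFiniteQuasiProjRes_iff_of_iso ((Q.isoHomologyι 0 (-1) (by simp)
      ((hQneg (-1) (by simp)).eq_of_tgt _ _)).symm ≪≫ hQ0.some)
  | succ n ih =>
    have hS := shortExact_opcycles Q (i := ((n + 1 : ℕ) : ℤ)) (j := n) (by simp)
      (hQres _ (by lia))
    exact (hasFiniteQuasiProjRes_iff_of_shortExact hfrob hS (hQproj n)).symm.trans ih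

end QPD

open QPD in
/-- In a Frobenius abelian category,
`qpd (M ⊕ P) = qpd M = qpd (Ω^i M)` for every projective `P`, every `i ≥ 0` and every
projective resolution `Q•` of `M` (the syzygy `Ω^i M` being realized as
`Coker(d_{i+1} : Q_{i+1} → Q_i)`). -/
theorem qpd_biprod_eq_qpd_eq_qpd_syzygy_of_frobenius {A : Type*} [Category A] [Abelian A]
    [EnoughProjectives A] [EnoughInjectives A]
    (hfrob : ∀ X : A, Projective X ↔ Injective X)
    (M P : A) (hP : Projective P) (i : ℕ)
    (Q : ChainComplex A ℤ)
    (hQproj : ∀ j, Projective (Q.X j))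
    (hQneg : ∀ j : ℤ, j < 0 → IsZero (Q.X j))
    (hQres : ∀ j : ℤ, j ≠ 0 → IsZero (Q.homology j))
    (hQ0 : Nonempty (Q.homology 0 ≅ M)) :
    qpd (M ⊞ P) = qpd M ∧ qpd M = qpd (cokernel (Q.d ((i : ℤ) + 1) (i : ℤ))) := by
  refine ⟨qpd_congr hfrob (hasFiniteQuasiProjRes_biprod_iff hfrob M P), qpd_congr hfrob ?_⟩
  rw [← hasFiniteQuasiProjRes_opcycles_iff hfrob Q hQproj hQneg hQres hQ0 i]
  exact hasFiniteQuasiProjRes_iff_of_iso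
    (IsColimit.coconePointUniqueUpToIso (Q.opcyclesIsCokernel (i + 1) i (by simp))
      (colimit.isColimit _))
end

section
/- Let R and S be left Noetherian rings. If R and S are Morita equivalent (i.e., their categories of left modules are equivalent as abelian categories), then qgldim(R) = qgldim(S). -/
/-!
Quasi-projective dimension, following Gheibi–Jorgensen–Takahashi and
Chen–Chen–Liu, "Properties of quasi-projective dimension over abelian categories".
-/

open CategoryTheory CategoryTheory.Limits

attribute [local instance] CategoryTheory.Abelian.hasFiniteBiproducts

namespace QPD

/-- An additive functor commutes with finite direct sums of copies of an object. -/
noncomputable def mapCopiesIso {A B : Type*} [Category A] [Abelian A] [Category B] [Abelian B]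
    (F : A ⥤ B) [F.Additive] {M : A} {N : B} (i : N ≅ F.obj M) (n : ℕ) :
    F.obj (copies M n) ≅ copies N n :=
  F.mapBiproduct (fun _ : Fin n => M) ≪≫ biproduct.mapIso (fun _ => i.symm)

/-- An equivalence of abelian categories does not increase the quasi-projective dimension. -/
theorem qpd_le_of_iso_functor_obj {A B : Type*} [Category A] [Abelian A] [Category B] [Abelian B]
    (F : A ⥤ B) [F.IsEquivalence] {M : A} {N : B} (i : N ≅ F.obj M) : qpd N ≤ qpd M := by
  have : F.Additive := F.additive_of_preserves_binary_products
  have isZero_iff (X : A) : IsZero (F.obj X) ↔ IsZero X := by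
    refine ⟨fun h => ?_, F.map_isZero⟩
    rw [IsZero.iff_id_eq_zero] at h ⊢
    apply F.map_injective
    simpa using h
  have hMN : IsZero N ↔ IsZero M := i.isZero_iff.trans (isZero_iff M)
  by_cases hM : IsZero M
  · simp [qpd, hM, hMN]
  rw [qpd, qpd, if_neg hM, if_neg (hMN.not.2 hM)]
  apply sInf_le_sInf
  rintro d ⟨P, s, t, hP, hs, ht, rfl⟩
  let Q : ChainComplex B ℤ := (F.mapHomologicalComplex _).obj P
  have homologyIso (j : ℤ) : Q.homology j ≅ F.obj (P.homology j) := (P.sc j).mapHomologyIso F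
  have isZero_X (j : ℤ) : IsZero (Q.X j) ↔ IsZero (P.X j) := isZero_iff _
  have isZero_homology (j : ℤ) : IsZero (Q.homology j) ↔ IsZero (P.homology j) :=
    (homologyIso j).isZero_iff.trans (isZero_iff _)
  refine ⟨Q, s, t, ⟨⟨?_, ?_, ?_⟩, ?_⟩, ?_, ?_, rfl⟩
  · exact fun j => (F.asEquivalence.map_projective_iff _).2 (hP.projective j)
  · simpa only [isZero_X] using hP.bddBelow
  · obtain ⟨mult, hmult, h⟩ := hP.homology_iso
    exact ⟨mult, hmult, fun j => (h j).map fun f =>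
      homologyIso j ≪≫ F.mapIso f ≪≫ mapCopiesIso F i _⟩
  · simpa only [isZero_X] using hP.bddAbove
  · simpa only [IsSup, isZero_X] using hs
  · simpa only [IsHSup, isZero_homology] using ht

/-- Equivalences between module categories preserve Noetherian modules. -/
theorem isNoetherian_functor_obj {R : Type*} {S : Type*} [Ring R] [Ring S]
    (e : ModuleCat.{v} R ≌ ModuleCat.{w} S) (M : ModuleCat.{v} R) [IsNoetherian R M] :
    IsNoetherian S (e.functor.obj M) := by
  let f : Submodule R M ≃o Submodule S (e.functor.obj M) :=
    (ModuleCat.subobjectModule M).symm.trans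
      ((Subobject.lowerEquivalence (MonoOver.congr M e)).toOrderIso.trans
        (ModuleCat.subobjectModule (e.functor.obj M)))
  have : WellFoundedGT (Submodule R M) := inferInstance
  rw [isNoetherian_iff']
  exact f.symm.toOrderEmbedding.wellFoundedGT

theorem qgldim_le_of_equivalence {R S : Type u} [Ring R] [Ring S] [IsNoetherianRing R]
    (e : ModuleCat.{u} R ≌ ModuleCat.{u} S) : qgldim R ≤ qgldim S := by
  apply sSup_le
  rintro d ⟨M, hM, rfl⟩
  have := isNoetherian_functor_obj e M
  exact (qpd_le_of_iso_functor_obj e.inverse (e.unitIso.app M)).trans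
    (le_sSup ⟨e.functor.obj M, inferInstance, rfl⟩)

end QPD

open QPD in
/-- Morita equivalent left Noetherian rings have the same quasi-global
dimension. -/
theorem qgldim_eq_of_moritaEquivalent {R S : Type u} [Ring R] [Ring S]
    [IsNoetherianRing R] [IsNoetherianRing S]
    (e : ModuleCat.{u} R ≌ ModuleCat.{u} S) :
    qgldim R = qgldim S :=
  (qgldim_le_of_equivalence e).antisymm (qgldim_le_of_equivalence e.symm)
end
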